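/- For the DRB game on the k-dimensional grid, there exist constants c1, c2 > 0 and n0 ∈ ℕ (all depending only on k and the granularity γ) such that for all n ≥ n0: the optimal social welfare satisfies c1 · n^{k+1}/(ln n)^2 ≤ max over all strategy profiles r of SW(r) ≤ c2 · n^{k+1}/(ln n)^2. -/

import Mathlib

open Finset

noncomputable section

namespace DRB

/-- Nodes of the `k`-dimensional grid (torus) with side length `n`. -/
abbrev Node (n k : ℕ) := Fin k → Fin n

/-- Grid (Manhattan) distance on the torus:
`d_M(u,v) = Σ_i min(|u_i - v_i|, n - |u_i - v_i|)`. -/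
def dM (n k : ℕ) (u v : Node n k) : ℕ :=
  ∑ i, min ((u i : ℤ) - (v i : ℤ)).natAbs (n - ((u i : ℤ) - (v i : ℤ)).natAbs)

/-- All nodes different from `u`. -/
def others (n k : ℕ) (u : Node n k) : Finset (Node n k) :=
  Finset.univ.filter (fun v => v ≠ u)

/-- Normalization constant `c(s) = Σ_{v ≠ u} d_M(u,v)^{-s}` for node `u`. -/
def cnorm (n k : ℕ) (u : Node n k) (s : ℝ) : ℝ :=
  ∑ v ∈ others n k u, (dM n k u v : ℝ) ^ (-s)

/-- Long-range link probability `p_u(v, s) = d_M(u,v)^{-s} / c(s)`. -/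
def linkProb (n k : ℕ) (u v : Node n k) (s : ℝ) : ℝ :=
  (dM n k u v : ℝ) ^ (-s) / cnorm n k u s

/-- Link distance `D(s) = Σ_{v ≠ u} p_u(v,s) · d_M(u,v)` of node `u`. -/
def linkDist (n k : ℕ) (u : Node n k) (s : ℝ) : ℝ :=
  ∑ v ∈ others n k u, linkProb n k u v s * (dM n k u v : ℝ)

/-- Reciprocity `P_u(r) = Σ_{v ≠ u} p_u(v, r_u) · p_v(u, r_v)`. -/
def recip (n k : ℕ) (r : Node n k → ℝ) (u : Node n k) : ℝ :=
  ∑ v ∈ others n k u, linkProb n k u v (r u) * linkProb n k v u (r v)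

/-- DRB payoff `π_u(r) = D(r_u) · P_u(r)`. -/
def payoff (n k : ℕ) (r : Node n k → ℝ) (u : Node n k) : ℝ :=
  linkDist n k u (r u) * recip n k r u

/-- Membership in the strategy set `Σ = {0, γ, 2γ, 3γ, ...}`. -/
def InSigma (γ s : ℝ) : Prop := ∃ m : ℕ, s = m * γ

/-- A valid strategy profile (every coordinate lies in `Σ`). -/
def ValidProfile (n k : ℕ) (γ : ℝ) (r : Node n k → ℝ) : Prop :=
  ∀ u, InSigma γ (r u)

/-- Nash equilibrium of the DRB game with strategy set `Σ` of granularity `γ`. -/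
def IsNash (n k : ℕ) (γ : ℝ) (r : Node n k → ℝ) : Prop :=
  ∀ u : Node n k, ∀ s : ℝ, InSigma γ s →
    payoff n k r u ≥ payoff n k (Function.update r u s) u

/-- Strict Nash equilibrium. -/
def IsStrictNash (n k : ℕ) (γ : ℝ) (r : Node n k → ℝ) : Prop :=
  ∀ u : Node n k, ∀ s : ℝ, InSigma γ s → s ≠ r u →
    payoff n k r u > payoff n k (Function.update r u s) u

/-- `t`-strong Nash equilibrium: no coalition of size ≤ `t` has a weakly
improving joint deviation that strictly improves some member. -/
def IsTStrongNash (n k : ℕ) (γ : ℝ) (t : ℕ) (r : Node n k → ℝ) : Prop :=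
  ¬ ∃ (C : Finset (Node n k)) (s : Node n k → ℝ),
      C.Nonempty ∧ C.card ≤ t ∧ (∀ u ∈ C, InSigma γ (s u)) ∧
      (∀ u ∈ C,
        payoff n k (fun v => if v ∈ C then s v else r v) u ≥ payoff n k r u) ∧
      (∃ u ∈ C,
        payoff n k (fun v => if v ∈ C then s v else r v) u > payoff n k r u)

/-- Strong Nash equilibrium: coalitions of any size. -/
def IsStrongNash (n k : ℕ) (γ : ℝ) (r : Node n k → ℝ) : Prop :=
  ¬ ∃ (C : Finset (Node n k)) (s : Node n k → ℝ),
      C.Nonempty ∧ (∀ u ∈ C, InSigma γ (s u)) ∧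
      (∀ u ∈ C,
        payoff n k (fun v => if v ∈ C then s v else r v) u ≥ payoff n k r u) ∧
      (∃ u ∈ C,
        payoff n k (fun v => if v ∈ C then s v else r v) u > payoff n k r u)

/-- `b_u(j)`: the number of nodes at grid distance exactly `j` from `u`. -/
def countAt (n k : ℕ) (u : Node n k) (j : ℕ) : ℕ :=
  (Finset.univ.filter (fun v => v ≠ u ∧ dM n k u v = j)).card

/-- One asynchronous best-response step: a single node switches to a best
response to the current profile, all other strategies unchanged. -/
def BRStep (n k : ℕ) (γ : ℝ) (r r' : Node n k → ℝ) : Prop :=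
  ∃ (u : Node n k) (s : ℝ), InSigma γ s ∧
    (∀ t : ℝ, InSigma γ t →
      payoff n k (Function.update r u s) u ≥ payoff n k (Function.update r u t) u) ∧
    r' = Function.update r u s

/-- One synchronous best-response step: every node simultaneously switches
to a best response to the current profile `r`. -/
def SyncStep (n k : ℕ) (γ : ℝ) (r r' : Node n k → ℝ) : Prop :=
  ∀ u : Node n k, InSigma γ (r' u) ∧
    ∀ t : ℝ, InSigma γ t →
      payoff n k (Function.update r u (r' u)) u ≥
        payoff n k (Function.update r u t) u

end DRB

namespace DRB

/-- circular distance -/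
def cd (n : ℕ) (x y : Fin n) : ℕ :=
  min ((x : ℤ) - (y : ℤ)).natAbs (n - ((x : ℤ) - (y : ℤ)).natAbs)

lemma dM_eq (n k : ℕ) (u v : Node n k) : dM n k u v = ∑ i, cd n (u i) (v i) := rfl

lemma cd_comm (n : ℕ) (x y : Fin n) : cd n x y = cd n y x := by
  unfold cd; have := x.2; have := y.2; omega

lemma dM_comm (n k : ℕ) (u v : Node n k) : dM n k u v = dM n k v u := by
  simp only [dM_eq, cd_comm n (u _)]

lemma cd_le (n : ℕ) (x y : Fin n) : cd n x y ≤ n := by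
  unfold cd; have := x.2; have := y.2; omega

lemma cd_self (n : ℕ) (x : Fin n) : cd n x x = 0 := by
  unfold cd; simp

lemma cd_pos (n : ℕ) (x y : Fin n) (h : y ≠ x) : 1 ≤ cd n x y := by
  have h' : (y : ℕ) ≠ x := fun e => h (Fin.ext e)
  unfold cd; have := x.2; have := y.2; omega

lemma dM_le (n k : ℕ) (u v : Node n k) : dM n k u v ≤ k * n := by
  rw [dM_eq]
  calc _ ≤ ∑ i : Fin k, n := Finset.sum_le_sum fun i _ => cd_le n _ _
    _ = k * n := by simp

lemma dM_pos (n k : ℕ) (u v : Node n k) (h : v ≠ u) : 1 ≤ dM n k u v := by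
  obtain ⟨i, hi⟩ := Function.ne_iff.mp h
  rw [dM_eq]
  exact (cd_pos n _ _ hi).trans (Finset.single_le_sum (f := fun i => cd n (u i) (v i)) (fun _ _ => Nat.zero_le _) (mem_univ i))

lemma mem_others {n k : ℕ} {u v : Node n k} : v ∈ others n k u ↔ v ≠ u := by
  simp [others]

lemma card_cd_eq (n : ℕ) (x : Fin n) (m : ℕ) :
    (univ.filter (fun y : Fin n => cd n x y = m)).card ≤ 4 := by
  have : (univ.filter (fun y : Fin n => cd n x y = m)).card ≤
      ({(x:ℤ) + m, (x:ℤ) - m, (x:ℤ) + m - n, (x:ℤ) - m + n} : Finset ℤ).card := by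
    apply Finset.card_le_card_of_injOn (fun y : Fin n => (y : ℤ))
    · intro y hy
      have hy : cd n x y = m := by simpa using hy
      unfold cd at hy
      have := x.2; have := y.2
      simp only [coe_insert, coe_singleton, Set.mem_insert_iff, Set.mem_singleton_iff]
      omega
    · intro a _ b _ h
      apply Fin.ext
      simpa using h
  refine this.trans Finset.card_le_four

lemma card_cd_le (n : ℕ) (x : Fin n) (m : ℕ) :
    (univ.filter (fun y : Fin n => cd n x y ≤ m)).card ≤ 4 * (m + 1) := by
  have := Finset.card_le_mul_card_image_of_maps_to (f := fun y : Fin n => cd n x y)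
    (s := univ.filter (fun y : Fin n => cd n x y ≤ m)) (t := range (m+1))
    (by intro y hy; simp at hy; simpa using Nat.lt_succ_of_le hy) 4 (by
      intro b _
      refine le_trans (Finset.card_le_card ?_) (card_cd_eq n x b)
      intro y hy; simp at hy; simp [hy.2])
  simpa using this

lemma card_dM_eq (n K : ℕ) (u : Node n (K+1)) (j : ℕ) (hj : 1 ≤ j) :
    (univ.filter (fun v : Node n (K+1) => dM n (K+1) u v = j)).card ≤ 4 * 8 ^ K * j ^ K := by
  set T : Finset (Fin K → Fin n) :=
    Fintype.piFinset (fun i => univ.filter (fun y : Fin n => cd n (u i.succ) y ≤ j)) with hT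
  have h1 : T.card ≤ (8 * j) ^ K := by
    rw [hT, Fintype.card_piFinset]
    calc _ ≤ ∏ i : Fin K, (8 * j) := Finset.prod_le_prod' fun i _ =>
          (card_cd_le n _ _).trans (by omega)
      _ = _ := by simp
  have h2 := Finset.card_le_mul_card_image_of_maps_to (f := fun v : Node n (K+1) => (Fin.tail v : Fin K → Fin n))
    (s := univ.filter (fun v : Node n (K+1) => dM n (K+1) u v = j)) (t := T) (by
      intro v hv
      simp only [mem_filter, mem_univ, true_and] at hv
      rw [hT, Fintype.mem_piFinset]
      intro i
      simp only [mem_filter, mem_univ, true_and]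
      rw [dM_eq, Fin.sum_univ_succ] at hv
      have := Finset.single_le_sum (f := fun i : Fin K => cd n (u i.succ) (v i.succ)) (fun _ _ => Nat.zero_le _) (mem_univ i)
      simp only [Fin.tail]
      omega) 4 (by
      intro b _
      refine le_trans ?_ (card_cd_eq n (u 0) (j - ∑ i : Fin K, cd n (u i.succ) (b i)))
      apply Finset.card_le_card_of_injOn (fun v => v 0)
      · intro v hv
        simp only [coe_filter, mem_filter, mem_univ, true_and, Set.mem_ofPred_eq] at hv ⊢
        obtain ⟨hv, rfl⟩ := hv
        rw [dM_eq, Fin.sum_univ_succ] at hv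
        simp only [Fin.tail]
        omega
      · intro a ha c hc h
        simp only [coe_filter, mem_filter, mem_univ, true_and, Set.mem_ofPred_eq] at ha hc
        rw [← Fin.cons_self_tail a, ← Fin.cons_self_tail c]
        have h : a 0 = c 0 := h
        have e : Fin.tail a = Fin.tail c := ha.2.trans hc.2.symm
        rw [h, e])
  calc _ ≤ 4 * T.card := h2
    _ ≤ 4 * (8 * j) ^ K := by gcongr
    _ = _ := by rw [mul_pow]; ring

lemma sum_others_le (n K : ℕ) (u : Node n (K+1)) (a : ℝ) :
    ∑ v ∈ others n (K+1) u, (dM n (K+1) u v : ℝ) ^ (-a) ≤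
      4 * 8 ^ K * ∑ j ∈ Icc 1 ((K+1) * n), (j : ℝ) ^ ((K : ℝ) - a) := by
  rw [← Finset.sum_fiberwise_of_maps_to (s := others n (K+1) u) (t := Icc 1 ((K+1)*n))
    (g := fun v => dM n (K+1) u v)]
  · rw [Finset.mul_sum]
    apply Finset.sum_le_sum
    intro j hj
    have hj1 : 1 ≤ j := (mem_Icc.mp hj).1
    have hj0 : (0:ℝ) < j := by exact_mod_cast hj1
    rw [Finset.sum_congr rfl (g := fun _ => (j:ℝ) ^ (-a))]
    · rw [sum_const, nsmul_eq_mul, sub_eq_add_neg, Real.rpow_add hj0, ← mul_assoc, Real.rpow_natCast]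
      gcongr
      have := (Finset.card_le_card (s := (others n (K+1) u).filter (fun v => dM n (K+1) u v = j))
        (t := univ.filter (fun v : Node n (K+1) => dM n (K+1) u v = j)) (by
          intro v hv; simp at hv; simp [hv.2])).trans (card_dM_eq n K u j hj1)
      exact_mod_cast this
    · intro v hv
      rw [(mem_filter.mp hv).2]
  · intro v hv
    exact mem_Icc.mpr ⟨dM_pos _ _ _ _ (mem_others.mp hv), dM_le _ _ _ _⟩

/-- harmonic sums -/
lemma harm_eq (N : ℕ) : ∑ j ∈ Icc 1 N, (j : ℝ) ^ (-1 : ℝ) = (harmonic N : ℝ) := by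
  rw [harmonic_eq_sum_Icc]
  push_cast
  simp only [Real.rpow_neg_one]

lemma sum_rpow_le (γ : ℝ) (h0 : 0 ≤ γ) (h1 : γ < 1) (N : ℕ) :
    ∑ j ∈ Icc 1 N, (j : ℝ) ^ (-γ) ≤ (1 - γ)⁻¹ * (N : ℝ) ^ (1 - γ) := by
  induction N with
  | zero => simp; positivity
  | succ N ih =>
    rw [Finset.sum_Icc_succ_top (by omega)]
    refine (add_le_add_left ih _).trans ?_
    have hp : (0:ℝ) < ((N+1 : ℕ) : ℝ) := by positivity
    set x : ℝ := ((N+1 : ℕ) : ℝ) with hx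
    have hN : (N : ℝ) = x * (1 + (-1/x)) := by
      rw [hx]; field_simp; push_cast; ring
    have hx1 : 1 ≤ x := by rw [hx]; push_cast; linarith [Nat.cast_nonneg (α := ℝ) N]
    have hb := rpow_one_add_le_one_add_mul_self (s := -1/x) (by rw [neg_div, neg_le_neg_iff]; exact (div_le_one hp).2 hx1) (p := 1 - γ) (by linarith) (by linarith)
    have h2 : (N : ℝ) ^ (1 - γ) ≤ x ^ (1 - γ) * (1 + (1-γ) * (-1/x)) := by
      rw [hN, Real.mul_rpow hp.le]
      · gcongr
      · have : 1 / x ≤ 1 := (div_le_one hp).2 hx1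
        rw [neg_div]; linarith
    have h3 : x ^ (1 - γ) = x * x ^ (-γ) := by
      rw [sub_eq_add_neg, Real.rpow_add hp, Real.rpow_one]
    have h4 : (0:ℝ) < 1 - γ := by linarith
    calc _ ≤ (1 - γ)⁻¹ * (x ^ (1 - γ) * (1 + (1-γ) * (-1/x))) + x ^ (-γ) := by gcongr
      _ = _ := by rw [h3]; field_simp; ring

end DRB

namespace DRB

lemma exists_nbr (n K : ℕ) (hn : 2 ≤ n) (u : Node n (K+1)) :
    ∃ v : Node n (K+1), v ≠ u ∧ dM n (K+1) u v = 1 ∧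
      ((v 0 : ℕ) % 2 ≠ (u 0 : ℕ) % 2) := by
  obtain ⟨y, hy1, hy2⟩ : ∃ y : Fin n, cd n (u 0) y = 1 ∧ (y : ℕ) % 2 ≠ (u 0 : ℕ) % 2 := by
    have := (u 0).2
    by_cases h : (u 0 : ℕ) + 1 < n
    · refine ⟨⟨(u 0 : ℕ) + 1, h⟩, ?_, ?_⟩
      · unfold cd; simp only; omega
      · simp only; omega
    · refine ⟨⟨(u 0 : ℕ) - 1, by omega⟩, ?_, ?_⟩
      · unfold cd; simp only; omega
      · simp only; omega
  refine ⟨Function.update u 0 y, ?_, ?_, ?_⟩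
  · intro h
    have := congrFun h 0
    rw [Function.update_self] at this
    rw [this] at hy2; exact hy2 rfl
  · rw [dM_eq, Fin.sum_univ_succ, Function.update_self, hy1]
    simp [cd_self]
  · rwa [Function.update_self]

lemma cnorm_ge_one (n K : ℕ) (hn : 2 ≤ n) (u : Node n (K+1)) (s : ℝ) :
    1 ≤ cnorm n (K+1) u s := by
  obtain ⟨v, hv, hd, _⟩ := exists_nbr n K hn u
  unfold cnorm
  refine le_trans ?_ (Finset.single_le_sum (f := fun v => (dM n (K+1) u v : ℝ) ^ (-s))
    (fun _ _ => by positivity) (mem_others.mpr hv))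
  simp [hd]

lemma sum_ge (n K : ℕ) (hn : 2 ≤ n) (u : Node n (K+1)) (s : ℝ) (hs : 0 ≤ s) :
    (n : ℝ) ^ (K+1) / 2 * (((K+1 : ℕ) : ℝ) * n) ^ (-s) ≤
      ∑ v ∈ others n (K+1) u, (dM n (K+1) u v : ℝ) ^ (-s) := by
  have hc : (n : ℝ) ^ (K+1) / 2 ≤ ((others n (K+1) u).card : ℝ) := by
    have : (others n (K+1) u).card = n ^ (K+1) - 1 := by
      unfold others
      rw [Finset.filter_ne', Finset.card_erase_of_mem (mem_univ _)]
      simp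
    rw [this]
    have h2 : 2 ≤ n ^ (K+1) := hn.trans (Nat.le_self_pow (by omega) n)
    rw [Nat.cast_sub (by omega)]
    have h2' : (2:ℝ) ≤ (n:ℝ) ^ (K+1) := by exact_mod_cast h2
    push_cast; linarith
  calc _ ≤ ((others n (K+1) u).card : ℝ) * (((K+1 : ℕ) : ℝ) * n) ^ (-s) := by gcongr
    _ = ∑ v ∈ others n (K+1) u, (((K+1 : ℕ) : ℝ) * n) ^ (-s) := by simp
    _ ≤ _ := by
      apply Finset.sum_le_sum
      intro v hv
      have h1 := dM_pos _ _ _ _ (mem_others.mp hv)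
      have h2 : (dM n (K+1) u v : ℝ) ≤ ((K+1 : ℕ) : ℝ) * n := by exact_mod_cast dM_le _ _ _ _
      apply Real.rpow_le_rpow_of_nonpos (by exact_mod_cast h1) h2 (by linarith)

lemma cd_add_le (n : ℕ) [NeZero n] (x t : Fin n) : cd n x (x + t) ≤ t := by
  have hx := x.2; have ht := t.2
  unfold cd
  rw [Fin.val_add]
  by_cases h : (x : ℕ) + t < n
  · rw [Nat.mod_eq_of_lt h]; omega
  · have : ((x : ℕ) + t) % n = x + t - n := by
      rw [Nat.mod_eq_sub_mod (by omega), Nat.mod_eq_of_lt (by omega)]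
    rw [this]; omega

lemma cnorm_k_ge (n K : ℕ) (hn : 2 ≤ n) (u : Node n (K+1)) :
    ((K : ℝ) + 1) ^ (-((K : ℝ) + 1)) * Real.log n ≤ cnorm n (K+1) u ((K : ℝ) + 1) := by
  have : NeZero n := ⟨by omega⟩
  have hK : (0:ℝ) < (K:ℝ) + 1 := by positivity
  set G : Node n (K+1) → ℝ := fun v => (dM n (K+1) u v : ℝ) ^ (-((K : ℝ) + 1)) with hG
  have e1 : cnorm n (K+1) u ((K : ℝ) + 1) = ∑ v, G v := by
    unfold cnorm others
    rw [Finset.filter_ne']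
    rw [← Finset.sum_erase_add _ _ (mem_univ u)]
    have : G u = 0 := by
      have : dM n (K+1) u u = 0 := by rw [dM_eq]; simp [cd_self]
      rw [hG]; simp only [this, Nat.cast_zero]
      exact Real.zero_rpow (by linarith)
    rw [this, add_zero]
  have e2 : ∑ v, G v = ∑ x : Fin n, ∑ t : Fin K → Fin n, G (u + Fin.cons x t) := by
    rw [← Equiv.sum_comp (Equiv.addLeft u), ← Equiv.sum_comp (Fin.consEquiv (fun _ => Fin n)),
      Fintype.sum_prod_type]
    rfl
  have e3 : ∀ x : Fin n, ((K : ℝ) + 1) ^ (-((K : ℝ) + 1)) * ((x : ℕ) : ℝ)⁻¹ ≤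
      ∑ t : Fin K → Fin n, G (u + Fin.cons x t) := by
    intro x
    by_cases hx : (x : ℕ) = 0
    · rw [hx]; simp only [Nat.cast_zero, inv_zero, mul_zero]
      apply Finset.sum_nonneg; intro t _; rw [hG]; positivity
    have hx0 : (0:ℝ) < (x : ℕ) := by exact_mod_cast Nat.pos_of_ne_zero hx
    set T : Finset (Fin K → Fin n) := Fintype.piFinset (fun _ => Finset.Iic x) with hT
    have hcard : ((x : ℕ) : ℝ) ^ K ≤ (T.card : ℝ) := by
      rw [hT, Fintype.card_piFinset]
      simp only [Fin.card_Iic, prod_const, card_univ, Fintype.card_fin]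
      push_cast
      gcongr
      linarith
    calc _ = ((x : ℕ) : ℝ) ^ K * (((K : ℝ) + 1) * (x : ℕ)) ^ (-((K : ℝ) + 1)) := by
          rw [Real.mul_rpow hK.le hx0.le]
          have : (((x : ℕ) : ℝ))⁻¹ = ((x : ℕ) : ℝ) ^ K * ((x : ℕ) : ℝ) ^ (-((K : ℝ) + 1)) := by
            rw [← Real.rpow_natCast, ← Real.rpow_add hx0, ← Real.rpow_neg_one]
            congr 1; ring
          rw [this]; ring
      _ ≤ (T.card : ℝ) * (((K : ℝ) + 1) * (x : ℕ)) ^ (-((K : ℝ) + 1)) := by gcongr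
      _ = ∑ t ∈ T, (((K : ℝ) + 1) * (x : ℕ)) ^ (-((K : ℝ) + 1)) := by simp
      _ ≤ ∑ t ∈ T, G (u + Fin.cons x t) := by
          apply Finset.sum_le_sum
          intro t ht
          rw [hT, Fintype.mem_piFinset] at ht
          have hne : (u + Fin.cons x t : Node n (K+1)) ≠ u := by
            intro h
            have h0 := congrFun h 0
            simp only [Pi.add_apply, Fin.cons_zero, add_eq_left] at h0
            rw [h0] at hx; simp at hx
          have h1 := dM_pos _ _ _ _ hne
          have h2 : dM n (K+1) u (u + Fin.cons x t) ≤ (K+1) * (x : ℕ) := by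
            rw [dM_eq]
            calc _ ≤ ∑ i : Fin (K+1), (x : ℕ) := by
                  apply Finset.sum_le_sum
                  intro i _
                  refine (cd_add_le n (u i) _).trans ?_
                  refine Fin.cases ?_ (fun i => ?_) i
                  · simp
                  · have := ht i
                    rw [Finset.mem_Iic] at this
                    simpa using this
              _ = _ := by simp
          rw [hG]
          apply Real.rpow_le_rpow_of_nonpos (by exact_mod_cast h1) (by exact_mod_cast h2) (by linarith)
      _ ≤ _ := by
          apply Finset.sum_le_sum_of_subset_of_nonneg (subset_univ _)
          intro t _ _; rw [hG]; positivity
  rw [e1, e2]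
  refine le_trans ?_ (Finset.sum_le_sum fun x _ => e3 x)
  rw [← Finset.mul_sum]
  gcongr
  rw [Fin.sum_univ_eq_sum_range (fun i => ((i : ℕ) : ℝ)⁻¹) n]
  obtain ⟨m, rfl⟩ : ∃ m, n = m + 1 := ⟨n - 1, by omega⟩
  refine (log_add_one_le_harmonic m).trans ?_
  rw [Finset.sum_range_succ', harmonic]
  simp

/-- upper constants -/
def A0 (K : ℕ) : ℝ := 2 * ((K : ℝ) + 1) ^ ((K : ℝ) + 1)
def B1 (K : ℕ) : ℝ := 4 * 8 ^ K * ∑' j : ℕ, (j : ℝ) ^ (-2 : ℝ)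
def B2 (K : ℕ) : ℝ := 4 * 8 ^ K * (2 + Real.log ((K : ℝ) + 1))
def B3 (K : ℕ) : ℝ := 4 * 8 ^ K * (2 * ((K : ℝ) + 1))

lemma U1 (n K : ℕ) (u : Node n (K+1)) :
    ∑ v ∈ others n (K+1) u, (dM n (K+1) u v : ℝ) ^ (-((K : ℝ) + 2)) ≤ B1 K := by
  refine (sum_others_le n K u _).trans ?_
  unfold B1
  gcongr
  have : (K : ℝ) - (K + 2) = -2 := by ring
  rw [this]
  exact Summable.sum_le_tsum _ (fun _ _ => by positivity) (Real.summable_nat_rpow.mpr (by norm_num))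

lemma one_le_log (n : ℕ) (hn : 3 ≤ n) : 1 ≤ Real.log n := by
  rw [Real.le_log_iff_exp_le (by positivity)]
  have : (3:ℝ) ≤ n := by exact_mod_cast hn
  linarith [Real.exp_one_lt_three]

lemma U2 (n K : ℕ) (hn : 3 ≤ n) (u : Node n (K+1)) :
    ∑ v ∈ others n (K+1) u, (dM n (K+1) u v : ℝ) ^ (-((K : ℝ) + 1)) ≤ B2 K * Real.log n := by
  refine (sum_others_le n K u _).trans ?_
  unfold B2
  rw [mul_assoc (4 * 8 ^ K)]
  gcongr
  have : (K : ℝ) - (K + 1) = -1 := by ring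
  rw [this, harm_eq]
  refine (harmonic_le_one_add_log _).trans ?_
  have hn0 : (n : ℝ) ≠ 0 := by positivity
  push_cast
  rw [Real.log_mul (by positivity) hn0]
  have h1 := one_le_log n hn
  have h2 : 0 ≤ Real.log ((K:ℝ)+1) := Real.log_nonneg (by linarith [Nat.cast_nonneg (α := ℝ) K])
  nlinarith

lemma U3 (n K : ℕ) (u : Node n (K+1)) (γ : ℝ) (h0 : 0 ≤ γ) (h1 : γ ≤ 1/2) :
    ∑ v ∈ others n (K+1) u, (dM n (K+1) u v : ℝ) ^ (-((K : ℝ) + γ)) ≤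
      B3 K * (n : ℝ) ^ (1 - γ) := by
  refine (sum_others_le n K u _).trans ?_
  unfold B3
  rw [mul_assoc (4 * 8 ^ K)]
  gcongr
  have : (K : ℝ) - (K + γ) = -γ := by ring
  rw [this]
  refine (sum_rpow_le γ h0 (by linarith) _).trans ?_
  have hK : (1:ℝ) ≤ (K:ℝ)+1 := by linarith [Nat.cast_nonneg (α := ℝ) K]
  push_cast
  rw [Real.mul_rpow (by positivity) (by positivity), ← mul_assoc]
  gcongr
  · rw [inv_le_comm₀ (by linarith) (by norm_num)]; linarith
  · calc ((K:ℝ)+1) ^ (1 - γ) ≤ ((K:ℝ)+1) ^ (1:ℝ) := Real.rpow_le_rpow_of_exponent_le hK (by linarith)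
      _ = _ := Real.rpow_one _

lemma linkProb_le_a (n K : ℕ) (hn : 2 ≤ n) (u v : Node n (K+1)) (hv : v ≠ u) (s : ℝ) (hs : 0 ≤ s) :
    linkProb n (K+1) u v s ≤ 2 * ((((K:ℝ)+1) * n) / dM n (K+1) u v) ^ s / (n : ℝ) ^ (K+1) := by
  have h := sum_ge n K hn u s hs
  have hd : (0:ℝ) < dM n (K+1) u v := by exact_mod_cast dM_pos _ _ _ _ hv
  have hn0 : (0:ℝ) < n := by positivity
  push_cast at h
  unfold linkProb cnorm
  have hp : 0 < (n : ℝ) ^ (K+1) / 2 * (((K:ℝ)+1) * n) ^ (-s) := by positivity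
  refine (div_le_div_of_nonneg_left (by positivity) hp h).trans (le_of_eq ?_)
  rw [Real.div_rpow (by positivity) hd.le, Real.rpow_neg hd.le, Real.rpow_neg (by positivity)]
  field_simp

lemma ratio_ge (n K : ℕ) (u v : Node n (K+1)) (hv : v ≠ u) :
    1 ≤ (((K:ℝ)+1) * n) / dM n (K+1) u v := by
  have hd : (0:ℝ) < dM n (K+1) u v := by exact_mod_cast dM_pos _ _ _ _ hv
  rw [le_div_iff₀ hd, one_mul]
  exact_mod_cast dM_le _ _ _ _

lemma linkProb_le (n K : ℕ) (hn : 2 ≤ n) (u v : Node n (K+1)) (hv : v ≠ u) (s : ℝ) (hs : 0 ≤ s) :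
    linkProb n (K+1) u v s ≤ A0 K * (dM n (K+1) u v : ℝ) ^ (-((K : ℝ) + 1)) := by
  have hd1 : (1:ℝ) ≤ dM n (K+1) u v := by exact_mod_cast dM_pos _ _ _ _ hv
  have hd : (0:ℝ) < dM n (K+1) u v := by linarith
  have hn0 : (0:ℝ) < n := by positivity
  by_cases h : s ≤ (K:ℝ) + 1
  · refine (linkProb_le_a n K hn u v hv s hs).trans ?_
    calc _ ≤ 2 * ((((K:ℝ)+1) * n) / dM n (K+1) u v) ^ ((K:ℝ)+1) / (n : ℝ) ^ (K+1) := by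
          have := Real.rpow_le_rpow_of_exponent_le (ratio_ge n K u v hv) h
          gcongr
      _ = _ := by
          unfold A0
          rw [Real.div_rpow (by positivity) hd.le, Real.mul_rpow (by positivity) hn0.le,
            Real.rpow_neg hd.le]
          have : (n:ℝ) ^ ((K:ℝ)+1) = (n:ℝ) ^ (K+1) := by
            rw [← Real.rpow_natCast]; push_cast; rfl
          rw [this]
          field_simp
  · push Not at h
    unfold linkProb
    have hA : 1 ≤ A0 K := by
      unfold A0
      have : 1 ≤ ((K:ℝ)+1) ^ ((K:ℝ)+1) := Real.one_le_rpow (by linarith [Nat.cast_nonneg (α := ℝ) K]) (by positivity)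
      linarith
    calc _ ≤ (dM n (K+1) u v : ℝ) ^ (-s) := div_le_self (by positivity) (cnorm_ge_one n K hn u s)
      _ ≤ 1 * (dM n (K+1) u v : ℝ) ^ (-((K : ℝ) + 1)) := by
          rw [one_mul]; exact Real.rpow_le_rpow_of_exponent_le hd1 (by linarith)
      _ ≤ _ := by gcongr

lemma linkProb_le_small (n K : ℕ) (hn : 2 ≤ n) (u v : Node n (K+1)) (hv : v ≠ u) (s γ : ℝ)
    (hs : 0 ≤ s) (hγ : 0 ≤ γ) (h : s ≤ (K:ℝ) + 1 - γ) :
    linkProb n (K+1) u v s ≤ A0 K * (n : ℝ) ^ (-γ) := by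
  have hd1 : (1:ℝ) ≤ dM n (K+1) u v := by exact_mod_cast dM_pos _ _ _ _ hv
  have hn0 : (0:ℝ) < n := by positivity
  have hn1 : (1:ℝ) ≤ n := by exact_mod_cast (by omega : 1 ≤ n)
  have hK : (1:ℝ) ≤ (K:ℝ)+1 := by linarith [Nat.cast_nonneg (α := ℝ) K]
  refine (linkProb_le_a n K hn u v hv s hs).trans ?_
  calc _ ≤ 2 * (((K:ℝ)+1) * n) ^ s / (n : ℝ) ^ (K+1) := by
        gcongr
        exact div_le_self (by positivity) hd1
    _ ≤ 2 * (((K:ℝ)+1) ^ ((K:ℝ)+1) * (n:ℝ) ^ ((K:ℝ) + 1 - γ)) / (n : ℝ) ^ (K+1) := by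
        rw [Real.mul_rpow (by positivity) hn0.le]
        gcongr
        linarith
    _ = _ := by
        unfold A0
        rw [sub_eq_add_neg, Real.rpow_add hn0]
        have : (n:ℝ) ^ ((K:ℝ)+1) = (n:ℝ) ^ (K+1) := by
          rw [← Real.rpow_natCast]; push_cast; rfl
        rw [this]
        field_simp

lemma linkDist_eq (n K : ℕ) (u : Node n (K+1)) (s : ℝ) :
    linkDist n (K+1) u s =
      (∑ v ∈ others n (K+1) u, (dM n (K+1) u v : ℝ) ^ (-(s - 1))) / cnorm n (K+1) u s := by
  unfold linkDist linkProb
  rw [Finset.sum_div]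
  apply Finset.sum_congr rfl
  intro v hv
  have hd : (0:ℝ) < dM n (K+1) u v := by exact_mod_cast dM_pos _ _ _ _ (mem_others.mp hv)
  have : (dM n (K+1) u v : ℝ) ^ (-(s - 1)) = (dM n (K+1) u v : ℝ) ^ (-s) * dM n (K+1) u v := by
    rw [← Real.rpow_add_one hd.ne']; congr 1; ring
  rw [this]; ring

lemma cnorm_nonneg (n k : ℕ) (u : Node n k) (s : ℝ) : 0 ≤ cnorm n k u s :=
  Finset.sum_nonneg fun _ _ => by positivity

lemma linkProb_nonneg (n k : ℕ) (u v : Node n k) (s : ℝ) : 0 ≤ linkProb n k u v s :=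
  div_nonneg (by positivity) (cnorm_nonneg _ _ _ _)

lemma linkDist_nonneg (n k : ℕ) (u : Node n k) (s : ℝ) : 0 ≤ linkDist n k u s :=
  Finset.sum_nonneg fun _ _ => mul_nonneg (linkProb_nonneg _ _ _ _ _) (by positivity)

lemma recip_nonneg (n k : ℕ) (r : Node n k → ℝ) (u : Node n k) : 0 ≤ recip n k r u :=
  Finset.sum_nonneg fun _ _ => mul_nonneg (linkProb_nonneg _ _ _ _ _) (linkProb_nonneg _ _ _ _ _)

lemma payoff_nonneg (n k : ℕ) (r : Node n k → ℝ) (u : Node n k) : 0 ≤ payoff n k r u :=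
  mul_nonneg (linkDist_nonneg _ _ _ _) (recip_nonneg _ _ _ _)

lemma sum_linkProb (n K : ℕ) (hn : 2 ≤ n) (u : Node n (K+1)) (s : ℝ) :
    ∑ v ∈ others n (K+1) u, linkProb n (K+1) u v s = 1 := by
  unfold linkProb
  rw [← Finset.sum_div]
  exact div_self (by have := cnorm_ge_one n K hn u s; unfold cnorm at this; linarith)

lemma linkDist_le (n K : ℕ) (hn : 2 ≤ n) (u : Node n (K+1)) (s : ℝ) :
    linkDist n (K+1) u s ≤ ((K:ℝ)+1) * n := by
  calc _ ≤ ∑ v ∈ others n (K+1) u, linkProb n (K+1) u v s * (((K:ℝ)+1) * n) := by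
        apply Finset.sum_le_sum
        intro v _
        have := linkProb_nonneg n (K+1) u v s
        gcongr
        exact_mod_cast dM_le _ _ _ _
    _ = _ := by rw [← Finset.sum_mul, sum_linkProb n K hn, one_mul]

/-- A common bound: if `u`'s own link probabilities are at most `c * d^{-a}`. -/
lemma recip_le (n K : ℕ) (hn : 2 ≤ n) (r : Node n (K+1) → ℝ) (hr : ∀ v, 0 ≤ r v)
    (u : Node n (K+1)) (c a : ℝ)
    (h : ∀ v, v ≠ u → linkProb n (K+1) u v (r u) ≤ c * (dM n (K+1) u v : ℝ) ^ (-a)) :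
    recip n (K+1) r u ≤
      c * A0 K * ∑ v ∈ others n (K+1) u, (dM n (K+1) u v : ℝ) ^ (-(a + ((K:ℝ) + 1))) := by
  unfold recip
  rw [Finset.mul_sum]
  apply Finset.sum_le_sum
  intro v hv
  have hv' := mem_others.mp hv
  have hd : (0:ℝ) < dM n (K+1) u v := by exact_mod_cast dM_pos _ _ _ _ hv'
  have h2 := linkProb_le n K hn v u hv'.symm (r v) (hr v)
  rw [dM_comm] at h2
  calc _ ≤ (c * (dM n (K+1) u v : ℝ) ^ (-a)) * (A0 K * (dM n (K+1) u v : ℝ) ^ (-((K : ℝ) + 1))) :=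
        mul_le_mul (h v hv') h2 (linkProb_nonneg _ _ _ _ _) ((linkProb_nonneg _ _ _ _ _).trans (h v hv'))
    _ = _ := by rw [neg_add a, Real.rpow_add hd]; ring

lemma sum_mono (n K : ℕ) (u : Node n (K+1)) (a b : ℝ) (h : b ≤ a) :
    ∑ v ∈ others n (K+1) u, (dM n (K+1) u v : ℝ) ^ (-a) ≤
    ∑ v ∈ others n (K+1) u, (dM n (K+1) u v : ℝ) ^ (-b) := by
  apply Finset.sum_le_sum
  intro v hv
  have hd : (1:ℝ) ≤ dM n (K+1) u v := by exact_mod_cast dM_pos _ _ _ _ (mem_others.mp hv)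
  exact Real.rpow_le_rpow_of_exponent_le hd (by linarith)

lemma rpow_log (n : ℕ) (hn : 3 ≤ n) (γ : ℝ) (hγ : 0 < γ) :
    (n : ℝ) ^ (-γ) ≤ (3/γ)^3 / Real.log n ^ 3 := by
  have hL := one_le_log n hn
  have hn0 : (0:ℝ) < n := by positivity
  have h := Real.log_le_rpow_div hn0.le (ε := γ/3) (by positivity)
  have h3 : Real.log n ^ 3 ≤ (n:ℝ)^γ * (3/γ)^3 := by
    calc _ ≤ ((n:ℝ) ^ (γ/3) / (γ/3)) ^ 3 := by gcongr
      _ = ((n:ℝ) ^ (γ/3)) ^ 3 * (3/γ)^3 := by rw [← mul_pow]; congr 1; field_simp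
      _ = _ := by
        rw [← Real.rpow_natCast, ← Real.rpow_mul hn0.le]; congr 2; push_cast; ring
  rw [le_div_iff₀ (by positivity), Real.rpow_neg hn0.le, inv_mul_le_iff₀ (by positivity)]
  exact h3

lemma A0_pos (K : ℕ) : 0 < A0 K := by unfold A0; positivity
lemma B3_pos (K : ℕ) : 0 < B3 K := by unfold B3; positivity
lemma B2_pos (K : ℕ) : 0 < B2 K := by
  unfold B2
  have h2 : 0 ≤ Real.log ((K:ℝ)+1) := Real.log_nonneg (by linarith [Nat.cast_nonneg (α := ℝ) K])
  positivity
lemma B1_pos (K : ℕ) : 0 < B1 K := by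
  have h1 := cnorm_ge_one 2 K le_rfl (fun _ => 0) ((K:ℝ)+2)
  have h2 := U1 2 K (fun _ => 0)
  unfold cnorm at h1
  linarith

def c1' (K : ℕ) : ℝ := ((K : ℝ) + 1) ^ (-((K : ℝ) + 1))
lemma c1'_pos (K : ℕ) : 0 < c1' K := by unfold c1'; positivity

def UC (K : ℕ) (γ : ℝ) : ℝ :=
  (B3 K / c1' K) * ((c1' K)⁻¹ * A0 K * B1 K) + B3 K * (3/γ)^3 * (A0 K * A0 K * B1 K)
   + ((K:ℝ)+1) * (A0 K * (3/γ)^3 * A0 K * B2 K)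

lemma payoff_le (n K : ℕ) (hn : 3 ≤ n) (γ : ℝ) (hγ : 0 < γ) (hγ1 : γ ≤ 1/2)
    (r : Node n (K+1) → ℝ) (hr : ∀ v, 0 ≤ r v) (u : Node n (K+1))
    (htri : r u = (K:ℝ)+1 ∨ (K:ℝ)+1+γ ≤ r u ∨ r u ≤ (K:ℝ)+1-γ) :
    payoff n (K+1) r u ≤ UC K γ * n / Real.log n ^ 2 := by
  have hL := one_le_log n hn
  have hL0 : 0 < Real.log n := by linarith
  have hn0 : (0:ℝ) < n := by positivity
  have hn2 : 2 ≤ n := by omega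
  have := A0_pos K; have := B1_pos K; have := B2_pos K; have := B3_pos K; have := c1'_pos K
  have hlog := rpow_log n hn γ hγ
  set L := Real.log n with hLd
  unfold payoff
  have hrn := recip_nonneg n (K+1) r u
  have t1 : (B3 K / c1' K) * ((c1' K)⁻¹ * A0 K * B1 K) ≤ UC K γ := by
    unfold UC
    have : 0 ≤ B3 K * (3/γ)^3 * (A0 K * A0 K * B1 K) := by positivity
    have : 0 ≤ ((K:ℝ)+1) * (A0 K * (3/γ)^3 * A0 K * B2 K) := by positivity
    linarith
  have t2 : B3 K * (3/γ)^3 * (A0 K * A0 K * B1 K) ≤ UC K γ := by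
    unfold UC
    have : 0 ≤ (B3 K / c1' K) * ((c1' K)⁻¹ * A0 K * B1 K) := by positivity
    have : 0 ≤ ((K:ℝ)+1) * (A0 K * (3/γ)^3 * A0 K * B2 K) := by positivity
    linarith
  have t3 : ((K:ℝ)+1) * (A0 K * (3/γ)^3 * A0 K * B2 K) ≤ UC K γ := by
    unfold UC
    have : 0 ≤ (B3 K / c1' K) * ((c1' K)⁻¹ * A0 K * B1 K) := by positivity
    have : 0 ≤ B3 K * (3/γ)^3 * (A0 K * A0 K * B1 K) := by positivity
    linarith
  rcases htri with h | h | h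
  · have hc : c1' K * L ≤ cnorm n (K+1) u ((K:ℝ)+1) := cnorm_k_ge n K hn2 u
    have hD : linkDist n (K+1) u (r u) ≤ B3 K * n / (c1' K * L) := by
      rw [h, linkDist_eq]
      have h3 := U3 n K u 0 le_rfl (by norm_num)
      rw [sub_zero, Real.rpow_one, add_zero] at h3
      rw [add_sub_cancel_right]
      gcongr
    have hP : recip n (K+1) r u ≤ (c1' K * L)⁻¹ * A0 K * B1 K := by
      refine (recip_le n K hn2 r hr u (c1' K * L)⁻¹ ((K:ℝ)+1) ?_).trans ?_
      · intro v hv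
        rw [h]; unfold linkProb
        rw [div_eq_inv_mul]
        gcongr
      · gcongr
        refine (sum_mono n K u _ ((K:ℝ)+2) ?_).trans (U1 n K u)
        linarith [Nat.cast_nonneg (α := ℝ) K]
    calc _ ≤ (B3 K * n / (c1' K * L)) * ((c1' K * L)⁻¹ * A0 K * B1 K) := by gcongr
      _ = ((B3 K / c1' K) * ((c1' K)⁻¹ * A0 K * B1 K)) * n / L^2 := by field_simp
      _ ≤ _ := by gcongr
  · have hD : linkDist n (K+1) u (r u) ≤ B3 K * (n * ((3/γ)^3/L^3)) := by
      rw [linkDist_eq]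
      calc _ ≤ ∑ v ∈ others n (K+1) u, (dM n (K+1) u v : ℝ) ^ (-(r u - 1)) :=
            div_le_self (Finset.sum_nonneg fun _ _ => by positivity) (cnorm_ge_one n K hn2 u _)
        _ ≤ _ := sum_mono n K u _ ((K:ℝ) + γ) (by linarith)
        _ ≤ _ := U3 n K u γ hγ.le hγ1
        _ = B3 K * (n * (n:ℝ) ^ (-γ)) := by
            rw [sub_eq_add_neg, Real.rpow_add hn0, Real.rpow_one]
        _ ≤ _ := by gcongr
    have hP : recip n (K+1) r u ≤ A0 K * A0 K * B1 K := by
      refine (recip_le n K hn2 r hr u (A0 K) ((K:ℝ)+1) ?_).trans ?_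
      · intro v hv
        exact linkProb_le n K hn2 u v hv _ (hr u)
      · gcongr
        refine (sum_mono n K u _ ((K:ℝ)+2) ?_).trans (U1 n K u)
        linarith [Nat.cast_nonneg (α := ℝ) K]
    calc _ ≤ (B3 K * (n * ((3/γ)^3/L^3))) * (A0 K * A0 K * B1 K) := by gcongr
      _ = (B3 K * (3/γ)^3 * (A0 K * A0 K * B1 K)) * n / L^3 := by ring
      _ ≤ (B3 K * (3/γ)^3 * (A0 K * A0 K * B1 K)) * n / L^2 := by
          apply div_le_div_of_nonneg_left (by positivity) (by positivity)
          exact pow_le_pow_right₀ hL (by norm_num)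
      _ ≤ _ := by gcongr
  · have hD := linkDist_le n K hn2 u (r u)
    have hP : recip n (K+1) r u ≤ (A0 K * ((3/γ)^3/L^3)) * A0 K * (B2 K * L) := by
      refine (recip_le n K hn2 r hr u (A0 K * ((3/γ)^3/L^3)) 0 ?_).trans ?_
      · intro v hv
        rw [neg_zero, Real.rpow_zero, mul_one]
        refine (linkProb_le_small n K hn2 u v hv _ γ (hr u) hγ.le h).trans ?_
        gcongr
      · rw [zero_add]
        have := U2 n K hn u
        gcongr
    calc _ ≤ (((K:ℝ)+1) * n) * ((A0 K * ((3/γ)^3/L^3)) * A0 K * (B2 K * L)) := by gcongr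
      _ = (((K:ℝ)+1) * (A0 K * (3/γ)^3 * A0 K * B2 K)) * n / L^2 := by field_simp
      _ ≤ _ := by gcongr

lemma UC_pos (K : ℕ) (γ : ℝ) (hγ : 0 < γ) : 0 < UC K γ := by
  have := A0_pos K; have := B1_pos K; have := B2_pos K; have := B3_pos K; have := c1'_pos K
  unfold UC; positivity

/-- The profile achieving the optimal order: alternate `k` and `k+1`. -/
def prof (n K : ℕ) (u : Node n (K+1)) : ℝ :=
  if (u 0 : ℕ) % 2 = 0 then (K:ℝ)+1 else (K:ℝ)+2

def LC (K : ℕ) : ℝ :=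
  ((1/2) * ((K:ℝ)+1) ^ (-(K:ℝ)) / B2 K) * ((B2 K)⁻¹ * (B1 K)⁻¹)

lemma LC_pos (K : ℕ) : 0 < LC K := by
  have := B1_pos K; have := B2_pos K
  unfold LC; positivity

lemma payoff_ge (n K : ℕ) (hn : 3 ≤ n) (u : Node n (K+1)) (hu : (u 0 : ℕ) % 2 = 0) :
    LC K * n / Real.log n ^ 2 ≤ payoff n (K+1) (prof n K) u := by
  have hL := one_le_log n hn
  have hL0 : 0 < Real.log n := by linarith
  have hn0 : (0:ℝ) < n := by positivity
  have hn2 : 2 ≤ n := by omega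
  have := B1_pos K; have := B2_pos K
  have hru : prof n K u = (K:ℝ)+1 := by simp [prof, hu]
  have hc1 := cnorm_ge_one n K hn2 u ((K:ℝ)+1)
  have hc2 : cnorm n (K+1) u ((K:ℝ)+1) ≤ B2 K * Real.log n := U2 n K hn u
  have hD : (1/2) * ((K:ℝ)+1) ^ (-(K:ℝ)) * n / (B2 K * Real.log n) ≤
      linkDist n (K+1) u (prof n K u) := by
    rw [hru, linkDist_eq, add_sub_cancel_right]
    have h := sum_ge n K hn2 u K (by positivity)
    have e : (n : ℝ) ^ (K+1) / 2 * (((K+1 : ℕ) : ℝ) * n) ^ (-(K:ℝ)) =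
        (1/2) * ((K:ℝ)+1) ^ (-(K:ℝ)) * n := by
      push_cast
      rw [Real.mul_rpow (by positivity) hn0.le, Real.rpow_neg hn0.le, Real.rpow_natCast, pow_succ]
      field_simp
    rw [e] at h
    gcongr
  obtain ⟨v, hv, hd, hpar⟩ := exists_nbr n K hn2 u
  have hrv : prof n K v = (K:ℝ)+2 := by
    have : ¬ (v 0 : ℕ) % 2 = 0 := by omega
    simp [prof, this]
  have hP : (B2 K * Real.log n)⁻¹ * (B1 K)⁻¹ ≤ recip n (K+1) (prof n K) u := by
    unfold recip
    refine le_trans ?_ (Finset.single_le_sum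
      (f := fun v => linkProb n (K+1) u v (prof n K u) * linkProb n (K+1) v u (prof n K v))
      (fun _ _ => mul_nonneg (linkProb_nonneg _ _ _ _ _) (linkProb_nonneg _ _ _ _ _))
      (mem_others.mpr hv))
    have hc3 : cnorm n (K+1) v ((K:ℝ)+2) ≤ B1 K := U1 n K v
    have hc4 := cnorm_ge_one n K hn2 v ((K:ℝ)+2)
    simp only [hru, hrv]
    unfold linkProb
    rw [dM_comm n (K+1) v u, hd, Nat.cast_one, Real.one_rpow, Real.one_rpow, one_div, one_div]
    gcongr
  unfold payoff
  calc _ = ((1/2) * ((K:ℝ)+1) ^ (-(K:ℝ)) * n / (B2 K * Real.log n)) *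
        ((B2 K * Real.log n)⁻¹ * (B1 K)⁻¹) := by
        unfold LC; field_simp
    _ ≤ _ := mul_le_mul hD hP (by positivity) (linkDist_nonneg _ _ _ _)

lemma card_even (n K : ℕ) :
    (n:ℝ) ^ (K+1) / 2 ≤
      ((univ.filter (fun u : Node n (K+1) => (u 0 : ℕ) % 2 = 0)).card : ℝ) := by
  have h1 : (univ.filter (fun u : Node n (K+1) => ¬ (u 0 : ℕ) % 2 = 0)).card ≤
      (univ.filter (fun u : Node n (K+1) => (u 0 : ℕ) % 2 = 0)).card := by
    apply Finset.card_le_card_of_injOn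
      (fun u => Function.update u 0 ⟨(u 0 : ℕ) - 1, by have := (u 0).2; omega⟩)
    · intro u hu
      simp only [coe_filter, mem_univ, true_and, Set.mem_ofPred_eq] at hu ⊢
      rw [Function.update_self]
      simp only
      omega
    · intro a ha b hb h
      simp only [coe_filter, mem_univ, true_and, Set.mem_ofPred_eq] at ha hb
      simp only at h
      funext i
      have hi := congrFun h i
      by_cases h0 : i = 0
      · subst h0
        rw [Function.update_self, Function.update_self] at hi
        have := congrArg Fin.val hi
        simp only at this
        apply Fin.ext
        omega
      · rwa [Function.update_of_ne h0, Function.update_of_ne h0] at hi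
  have h2 := Finset.card_filter_add_card_filter_not (s := (univ : Finset (Node n (K+1)))) (fun u => (u 0 : ℕ) % 2 = 0)
  have h3 : (univ : Finset (Node n (K+1))).card = n ^ (K+1) := by simp
  rw [h3] at h2
  have h4 : n ^ (K+1) ≤ 2 * (univ.filter (fun u : Node n (K+1) => (u 0 : ℕ) % 2 = 0)).card := by omega
  have h5 : (n:ℝ) ^ (K+1) ≤ 2 * ((univ.filter (fun u : Node n (K+1) => (u 0 : ℕ) % 2 = 0)).card : ℝ) := by
    exact_mod_cast h4
  linarith

end DRB


/-- The optimal social welfare of the DRB game is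
`Θ(n^{k+1}/(ln n)^2)`: there are constants `c1, c2 > 0` and `n0` (depending only
on `k` and `γ`) such that for all `n ≥ n0`, some valid profile achieves at least
`c1·n^{k+1}/(ln n)^2` and every valid profile achieves at most
`c2·n^{k+1}/(ln n)^2`. -/
theorem optimal_social_welfare (k g : ℕ) (hk : 1 ≤ k) (hg : 2 ≤ g) :
    ∃ c1 c2 : ℝ, 0 < c1 ∧ 0 < c2 ∧ ∃ n0 : ℕ, ∀ n : ℕ, n0 ≤ n →
      (∃ r : DRB.Node n k → ℝ, DRB.ValidProfile n k (g : ℝ)⁻¹ r ∧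
        c1 * (n : ℝ) ^ (k + 1) / (Real.log n) ^ 2 ≤ ∑ u, DRB.payoff n k r u) ∧
      (∀ r : DRB.Node n k → ℝ, DRB.ValidProfile n k (g : ℝ)⁻¹ r →
        ∑ u, DRB.payoff n k r u ≤ c2 * (n : ℝ) ^ (k + 1) / (Real.log n) ^ 2) := by
  obtain ⟨K, rfl⟩ : ∃ K, k = K + 1 := ⟨k - 1, by omega⟩
  have hg0 : (0:ℝ) < g := by positivity
  have hγ : (0:ℝ) < (g:ℝ)⁻¹ := by positivity
  have hγ1 : (g:ℝ)⁻¹ ≤ 1/2 := by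
    rw [inv_le_comm₀ hg0 (by norm_num)]
    norm_num
    exact_mod_cast hg
  refine ⟨DRB.LC K / 2, DRB.UC K (g:ℝ)⁻¹, by have := DRB.LC_pos K; positivity,
    DRB.UC_pos K _ hγ, 3, fun n hn => ⟨⟨DRB.prof n K, ?_, ?_⟩, ?_⟩⟩
  · intro u
    unfold DRB.prof
    split_ifs
    · exact ⟨(K+1) * g, by push_cast; field_simp⟩
    · exact ⟨(K+2) * g, by push_cast; field_simp⟩
  · have hL := DRB.one_le_log n hn
    have := DRB.LC_pos K
    calc _ = ((n:ℝ) ^ (K+1) / 2) * (DRB.LC K * n / Real.log n ^ 2) := by ring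
      _ ≤ ((univ.filter (fun u : DRB.Node n (K+1) => (u 0 : ℕ) % 2 = 0)).card : ℝ) *
          (DRB.LC K * n / Real.log n ^ 2) := by
          have := DRB.card_even n K
          gcongr
      _ = ∑ u ∈ univ.filter (fun u : DRB.Node n (K+1) => (u 0 : ℕ) % 2 = 0),
          (DRB.LC K * n / Real.log n ^ 2) := by rw [sum_const, nsmul_eq_mul]
      _ ≤ ∑ u ∈ univ.filter (fun u : DRB.Node n (K+1) => (u 0 : ℕ) % 2 = 0),
          DRB.payoff n (K+1) (DRB.prof n K) u := by
          apply Finset.sum_le_sum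
          intro u hu
          exact DRB.payoff_ge n K hn u (by simpa using hu)
      _ ≤ _ := by
          apply Finset.sum_le_sum_of_subset_of_nonneg (subset_univ _)
          intro u _ _
          exact DRB.payoff_nonneg _ _ _ _
  · intro r hr
    have hr0 : ∀ v, 0 ≤ r v := by
      intro v
      obtain ⟨m, hm⟩ := hr v
      rw [hm]; positivity
    have hp : ∀ u, DRB.payoff n (K+1) r u ≤ DRB.UC K (g:ℝ)⁻¹ * n / Real.log n ^ 2 := by
      intro u
      apply DRB.payoff_le n K hn _ hγ hγ1 r hr0 u
      obtain ⟨m, hm⟩ := hr u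
      have key : (K:ℝ) + 1 = (((K+1) * g : ℕ) : ℝ) * (g:ℝ)⁻¹ := by push_cast; field_simp
      rw [hm, key]
      rcases lt_trichotomy m ((K+1)*g) with h | h | h
      · right; right
        have h' : (m:ℝ) + 1 ≤ (((K+1) * g : ℕ) : ℝ) := by exact_mod_cast h
        nlinarith
      · left; rw [h]
      · right; left
        have h' : (((K+1) * g : ℕ) : ℝ) + 1 ≤ (m:ℝ) := by exact_mod_cast h
        nlinarith
    calc _ ≤ ∑ u : DRB.Node n (K+1), DRB.UC K (g:ℝ)⁻¹ * n / Real.log n ^ 2 :=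
          Finset.sum_le_sum fun u _ => hp u
      _ = _ := by
          rw [sum_const, nsmul_eq_mul]
          simp only [card_univ, Fintype.card_pi, Fintype.card_fin, prod_const]
          push_cast
          ring
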